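/- Let X be a metric space and fix a sequence (φ_k)_{k≥1} of bounded continuous functions X → ℝ; let d_B be the associated distance on finite Borel measures. There is a universal constant C > 0 with the following property: for every 0 < ε < 1, every probability measure μ on a measurable space A, and all Borel measurable maps f, g : A → X such that d_B(δ_{f(a)}, δ_{g(a)}) < ε for every a ∈ A, one has d_B(f_#μ, g_#μ) < C ε (|log ε| + 1), where f_#μ denotes the push-forward of μ by f. -/

import Mathlib

open MeasureTheory Filter

universe u v

/-- The distance `d_B` on finite Borel measures associated to a fixed sequence
`(φ_k)_{k≥1}` of bounded continuous functions:
`d_B(P,Q) = Σ_{k≥1} 2^{-k} t_k/(1+t_k)` with `t_k = |∫ φ_k dP − ∫ φ_k dQ|`. -/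
noncomputable def dB {X : Type*} [TopologicalSpace X] [MeasurableSpace X]
    (φ : ℕ → BoundedContinuousFunction X ℝ) (P Q : Measure X) : ℝ :=
  ∑' k : ℕ, (1 / 2 ^ (k + 1)) *
    (|(∫ x, φ k x ∂P) - ∫ x, φ k x ∂Q| / (1 + |(∫ x, φ k x ∂P) - ∫ x, φ k x ∂Q|))

lemma div_one_add_le_one {t : ℝ} (ht : 0 ≤ t) : t / (1 + t) ≤ 1 := by
  rw [div_le_one (by linarith)]
  linarith

lemma summable_dB {X : Type*} [TopologicalSpace X] [MeasurableSpace X]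
    (φ : ℕ → BoundedContinuousFunction X ℝ) (P Q : Measure X) :
    Summable fun k : ℕ => (1 / 2 ^ (k + 1) : ℝ) *
      (|(∫ x, φ k x ∂P) - ∫ x, φ k x ∂Q| /
        (1 + |(∫ x, φ k x ∂P) - ∫ x, φ k x ∂Q|)) := by
  have hw : Summable fun k : ℕ => (1 / 2 ^ (k + 1) : ℝ) := by
    simpa using (summable_nat_add_iff 1).2 summable_geometric_two
  refine Summable.of_nonneg_of_le (fun k => by positivity) (fun k => ?_) hw
  exact mul_le_of_le_one_right (by positivity) (div_one_add_le_one (abs_nonneg _))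

/-- The dyadic weights below a threshold `c` add up to at most `2 * c`. -/
lemma sum_dyadic_lt_le (c : ℝ) (N : ℕ) :
    ∑ k ∈ Finset.range N, (if (1 / 2 ^ (k + 1) : ℝ) < c then (1 / 2 ^ (k + 1) : ℝ) else 0) ≤
      max 0 (2 * c - 2 * (1 / 2 ^ (N + 1))) := by
  induction N with
  | zero => simp
  | succ N ih =>
    rw [Finset.sum_range_succ]
    have hw : (1 / 2 ^ (N + 1 + 1) : ℝ) = (1 / 2 ^ (N + 1)) / 2 := by
      rw [pow_succ _ (N + 1)]
      field_simp
    rw [hw]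
    split_ifs with h
    · rw [max_eq_right (by linarith)] at ih
      exact le_max_of_le_right (by linarith)
    · rw [max_eq_left (by linarith)] at ih
      exact le_max_of_le_left (by linarith)

/-- If `w * (t / (1 + t)) < ε` pointwise, with `2 * ε ≤ w`, then `t ≤ 1`, so `t` is comparable
to `t / (1 + t)`. Otherwise `w` itself is small. -/
lemma weighted_integral_le {A : Type*} [MeasurableSpace A] {μ : Measure A}
    [IsProbabilityMeasure μ] {u : A → ℝ} (hu : Integrable u μ) {w ε : ℝ} (hw : 0 < w)
    (h : ∀ a, w * (|u a| / (1 + |u a|)) ≤ ε) :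
    w * (|∫ a, u a ∂μ| / (1 + |∫ a, u a ∂μ|)) ≤
      2 * (∫ a, w * (|u a| / (1 + |u a|)) ∂μ) + if w < 2 * ε then w else 0 := by
  have hint : 0 ≤ ∫ a, w * (|u a| / (1 + |u a|)) ∂μ :=
    integral_nonneg fun a => by positivity
  split_ifs with hwε
  · have := mul_le_of_le_one_right hw.le (div_one_add_le_one (abs_nonneg (∫ a, u a ∂μ)))
    linarith
  · have hle : ∀ a, |u a| ≤ 2 * (|u a| / (1 + |u a|)) := fun a => by
      have h0 := abs_nonneg (u a)
      have h1 : |u a| / (1 + |u a|) ≤ 1 / 2 := by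
        by_contra! hc
        nlinarith [h a]
      rw [div_le_iff₀ (by linarith)] at h1
      rw [mul_div_assoc', le_div_iff₀ (by linarith)]
      nlinarith
    have hi : Integrable (fun a => |u a| / (1 + |u a|)) μ := by
      refine Integrable.mono' hu.abs ?_ (ae_of_all _ fun a => ?_)
      · have := hu.abs.aestronglyMeasurable.aemeasurable
        exact (this.div (this.const_add 1)).aestronglyMeasurable
      · rw [Real.norm_of_nonneg (by positivity)]
        exact div_le_self (abs_nonneg _) (by linarith [abs_nonneg (u a)])
    calc w * (|∫ a, u a ∂μ| / (1 + |∫ a, u a ∂μ|))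
        ≤ w * |∫ a, u a ∂μ| := by
          gcongr
          exact div_le_self (abs_nonneg _) (by linarith [abs_nonneg (∫ a, u a ∂μ)])
      _ ≤ w * ∫ a, |u a| ∂μ := by
          gcongr
          exact abs_integral_le_integral_abs
      _ ≤ w * ∫ a, 2 * (|u a| / (1 + |u a|)) ∂μ := by
          exact mul_le_mul_of_nonneg_left (integral_mono hu.abs (hi.const_mul 2) hle) hw.le
      _ = 2 * (∫ a, w * (|u a| / (1 + |u a|)) ∂μ) + 0 := by
          rw [integral_const_mul, integral_const_mul]
          ring

lemma dB_map_le {X A : Type*} [MetricSpace X] [MeasurableSpace X] [BorelSpace X]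
    [MeasurableSpace A] (φ : ℕ → BoundedContinuousFunction X ℝ) {ε : ℝ} (hε : 0 < ε)
    (μ : Measure A) [IsProbabilityMeasure μ] {f g : A → X} (hf : Measurable f)
    (hg : Measurable g)
    (h : ∀ a : A, dB φ (Measure.dirac (f a)) (Measure.dirac (g a)) ≤ ε) :
    dB φ (Measure.map f μ) (Measure.map g μ) ≤ 6 * ε := by
  have hint : ∀ k, ∀ p : A → X, Measurable p → Integrable (fun a => φ k (p a)) μ :=
    fun k p hp => Integrable.of_bound
      ((φ k).continuous.measurable.comp hp).aestronglyMeasurable ‖φ k‖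
      (ae_of_all _ fun a => (φ k).norm_coe_le_norm _)
  have hu : ∀ k, Integrable (fun a => φ k (f a) - φ k (g a)) μ :=
    fun k => (hint k f hf).sub (hint k g hg)
  have hmap : ∀ k, (∫ x, φ k x ∂(Measure.map f μ)) - ∫ x, φ k x ∂(Measure.map g μ) =
      ∫ a, (φ k (f a) - φ k (g a)) ∂μ := fun k => by
    rw [integral_map hf.aemeasurable (φ k).continuous.measurable.aestronglyMeasurable,
      integral_map hg.aemeasurable (φ k).continuous.measurable.aestronglyMeasurable,
      integral_sub (hint k f hf) (hint k g hg)]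
  have hpart : ∀ (s : Finset ℕ) a, ∑ k ∈ s, (1 / 2 ^ (k + 1) : ℝ) *
      (|φ k (f a) - φ k (g a)| / (1 + |φ k (f a) - φ k (g a)|)) ≤ ε := fun s a => by
    have := (summable_dB φ (Measure.dirac (f a)) (Measure.dirac (g a))).sum_le_tsum s
      (fun k _ => by positivity)
    simp only [integral_dirac] at this
    refine this.trans ?_
    simpa only [dB, integral_dirac] using h a
  have hi : ∀ k : ℕ, Integrable (fun a => (1 / 2 ^ (k + 1) : ℝ) *
      (|φ k (f a) - φ k (g a)| / (1 + |φ k (f a) - φ k (g a)|))) μ := fun k => by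
    have hm := (hu k).abs.aestronglyMeasurable.aemeasurable
    refine Integrable.of_bound
      ((hm.div (hm.const_add 1)).const_mul _).aestronglyMeasurable ε (ae_of_all _ fun a => ?_)
    rw [Real.norm_of_nonneg (by positivity)]
    simpa using hpart {k} a
  refine (summable_dB φ _ _).tsum_le_of_sum_range_le fun N => ?_
  simp only [hmap]
  calc _ ≤ ∑ k ∈ Finset.range N, (2 * (∫ a, (1 / 2 ^ (k + 1) : ℝ) *
          (|φ k (f a) - φ k (g a)| / (1 + |φ k (f a) - φ k (g a)|)) ∂μ) +
          if (1 / 2 ^ (k + 1) : ℝ) < 2 * ε then (1 / 2 ^ (k + 1) : ℝ) else 0) :=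
        Finset.sum_le_sum fun k _ => weighted_integral_le (hu k) (by positivity)
          fun a => by simpa using hpart {k} a
    _ ≤ 2 * ε + 4 * ε := by
        rw [Finset.sum_add_distrib, ← Finset.mul_sum, ← integral_finsetSum _ fun k _ => hi k]
        refine add_le_add ?_ ?_
        · have := integral_mono (integrable_finsetSum _ fun k _ => hi k)
            (integrable_const (μ := μ) ε) (hpart (Finset.range N))
          simp only [integral_const, probReal_univ, one_smul] at this
          linarith
        · refine (sum_dyadic_lt_le (2 * ε) N).trans (max_le (by positivity) ?_)
          have : (0 : ℝ) < 1 / 2 ^ (N + 1) := by positivity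
          linarith
    _ = 6 * ε := by ring

/-- Lemma 4.19: there is a universal constant `C` such that if two maps `f, g` into a
metric space satisfy `d_B(δ_{f(a)}, δ_{g(a)}) < ε` pointwise, then the push-forwards of
any probability measure satisfy `d_B(f#μ, g#μ) < C ε (|log ε| + 1)`. -/
theorem stmt13 : ∃ C : ℝ, 0 < C ∧
    ∀ (X : Type u) [MetricSpace X] [MeasurableSpace X] [BorelSpace X]
      (φ : ℕ → BoundedContinuousFunction X ℝ)
      (ε : ℝ), 0 < ε → ε < 1 →
      ∀ (A : Type v) [MeasurableSpace A] (μ : Measure A), IsProbabilityMeasure μ →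
      ∀ f g : A → X, Measurable f → Measurable g →
      (∀ a : A, dB φ (Measure.dirac (f a)) (Measure.dirac (g a)) < ε) →
      dB φ (Measure.map f μ) (Measure.map g μ) < C * ε * (|Real.log ε| + 1) := by
  refine ⟨7, by norm_num, ?_⟩
  intro X _ _ _ φ ε hε _ A _ μ _ f g hf hg h
  have := dB_map_le φ hε μ hf hg fun a => (h a).le
  nlinarith [mul_nonneg hε.le (abs_nonneg (Real.log ε))]
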